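/- (Lemma 7.) Fix ρ ∈ (0, 3). Let W be a B-DMC with finite output alphabet, ε ∈ [0, 1], x ∈ [0, 1/2]. If E0(ρ, BSC_x) ≤ E0(ρ, W) ≤ E0(ρ, BEC_ε), then R(ρ, BSC_x) ≤ R(ρ, W) ≤ R(ρ, BEC_ε); moreover, if both hypothesis inequalities are strict, then both conclusion inequalities are strict. -/

import Mathlib

/-- A binary-input discrete memoryless channel: a nonempty finite output alphabet `Y`
together with conditional probability mass functions `W0 = W(·|0)` and `W1 = W(·|1)`. -/
structure BDMC where
  Y : Type
  [fin : Fintype Y]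
  [ne : Nonempty Y]
  W0 : Y → ℝ
  W1 : Y → ℝ
  W0_nonneg : ∀ y, 0 ≤ W0 y
  W1_nonneg : ∀ y, 0 ≤ W1 y
  sum_W0 : ∑ y, W0 y = 1
  sum_W1 : ∑ y, W1 y = 1

attribute [instance] BDMC.fin BDMC.ne

/-- Gallager's `E₀` function of a B-DMC under the uniform input distribution:
`E₀(ρ, W) = −log ∑_y (½ W(y|0)^{1/(1+ρ)} + ½ W(y|1)^{1/(1+ρ)})^{1+ρ}`. -/
noncomputable def E0 (ρ : ℝ) (W : BDMC) : ℝ :=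
  -Real.log (∑ y, ((1/2) * W.W0 y ^ (1/(1+ρ)) + (1/2) * W.W1 y ^ (1/(1+ρ))) ^ (1+ρ))

/-- `E₀` of the binary erasure channel with erasure probability `ε`:
`E₀(ρ, BEC_ε) = −log(2^{−ρ}(1−ε) + ε)`. -/
noncomputable def E0bec (ρ ε : ℝ) : ℝ := -Real.log ((2:ℝ) ^ (-ρ) * (1-ε) + ε)

/-- `E₀` of the binary symmetric channel with crossover probability `x`:
`E₀(ρ, BSC_x) = −log(2^{−ρ}(x^{1/(1+ρ)} + (1−x)^{1/(1+ρ)})^{1+ρ})`. -/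
noncomputable def E0bsc (ρ x : ℝ) : ℝ :=
  -Real.log ((2:ℝ) ^ (-ρ) * (x ^ (1/(1+ρ)) + (1-x) ^ (1/(1+ρ))) ^ (1+ρ))

/-- `R(ρ, W)`: the derivative of `ρ ↦ E₀(ρ, W)` at `ρ`. -/
noncomputable def RW (ρ : ℝ) (W : BDMC) : ℝ := deriv (fun r => E0 r W) ρ

/-- `R(ρ, BEC_ε)`: the derivative of `ρ ↦ E₀(ρ, BEC_ε)` at `ρ`. -/
noncomputable def Rbec (ρ ε : ℝ) : ℝ := deriv (fun r => E0bec r ε) ρ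

/-- `R(ρ, BSC_x)`: the derivative of `ρ ↦ E₀(ρ, BSC_x)` at `ρ`. -/
noncomputable def Rbsc (ρ x : ℝ) : ℝ := deriv (fun r => E0bsc r x) ρ

open Real

/-- A hyperbolic Huygens inequality. -/
lemma three_mul_le_two_sinh_add_tanh {y : ℝ} (hy : 0 ≤ y) :
    3 * y ≤ 2 * sinh y + sinh y / cosh y := by
  have hd : ∀ x : ℝ, HasDerivAt (fun y => 2 * sinh y + sinh y / cosh y - 3 * y)
      (2 * cosh x + (cosh x * cosh x - sinh x * sinh x) / cosh x ^ 2 - 3 * 1) x := fun x =>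
    (((hasDerivAt_sinh x).const_mul 2).add
      ((hasDerivAt_sinh x).div (hasDerivAt_cosh x) (cosh_pos x).ne')).sub
      ((hasDerivAt_id x).const_mul 3)
  have hm : Monotone (fun y => 2 * sinh y + sinh y / cosh y - 3 * y) := by
    refine monotone_of_deriv_nonneg (fun x => (hd x).differentiableAt) fun x => ?_
    rw [(hd x).deriv]
    have hc := one_le_cosh x
    have e : cosh x * cosh x - sinh x * sinh x = 1 := by nlinarith [cosh_sq x]
    have : 2 * cosh x + 1 / cosh x ^ 2 - 3 * 1
        = (cosh x - 1) ^ 2 * (2 * cosh x + 1) / cosh x ^ 2 := by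
      field_simp; ring
    rw [e, this]
    positivity
  have := hm hy
  simp at this
  linarith

/-- The Langevin bound `coth q - 1/q ≤ tanh p` for `q ≤ 3 p`, cleared of denominators. -/
lemma mul_cosh_sub_le_cosh_mul_sinh {p q : ℝ} (hq : 0 ≤ q) (hpq : q ≤ 3 * p) :
    q * cosh (q - p) ≤ cosh p * sinh q := by
  obtain ⟨t, rfl⟩ : ∃ t, q = 3 * t := ⟨q / 3, by ring⟩
  have ht : 0 ≤ t := by linarith
  have htp : t ≤ p := by linarith
  have base : 3 * t * cosh (3 * t - t) ≤ cosh t * sinh (3 * t) := by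
    have h := three_mul_le_two_sinh_add_tanh (y := 2 * t) (by linarith)
    have hc := cosh_pos (2 * t)
    have h' : 3 * (2 * t) * cosh (2 * t) ≤ (2 * sinh (2 * t) * cosh (2 * t) + sinh (2 * t)) := by
      have := mul_le_mul_of_nonneg_right h hc.le
      rw [add_mul, div_mul_cancel₀ _ hc.ne'] at this
      exact this
    have e1 : (3 * t - t) = 2 * t := by ring
    have e2 : sinh (3 * t) = sinh (2 * t) * cosh t + cosh (2 * t) * sinh t := by
      rw [← sinh_add]; ring_nf
    have e3 : cosh t * sinh (3 * t) = sinh (2 * t) * cosh (2 * t) + sinh (2 * t) / 2 := by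
      rw [e2, sinh_two_mul, cosh_two_mul]
      linear_combination (2 * sinh t * cosh t / 2) * (cosh_sq t)
    rw [e1, e3]
    linarith
  generalize 3 * t = q at *
  have key : cosh t * (cosh p * sinh q - q * cosh (q - p))
      = cosh p * (cosh t * sinh q - q * cosh (q - t)) + q * sinh q * sinh (p - t) := by
    simp only [cosh_sub, sinh_sub]
    ring
  have h1 : 0 ≤ sinh (p - t) := sinh_nonneg_iff.2 (by linarith)
  have h2 : 0 ≤ sinh q := sinh_nonneg_iff.2 hq
  have h3 := cosh_pos p
  have h4 : 0 ≤ cosh t * (cosh p * sinh q - q * cosh (q - p)) := by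
    rw [key]
    have : 0 ≤ cosh t * sinh q - q * cosh (q - t) := by linarith
    positivity
  linarith [nonneg_of_mul_nonneg_right h4 (cosh_pos t)]

/-- In the coordinate `v = ½ log (W(y|0) / W(y|1))`, with `s = 1 / (1 + r)`: the contribution of an
output letter of probability one to Gallager's sum. -/
noncomputable def letterG (s v : ℝ) : ℝ :=
  exp (1 / s * log (cosh (s * v)) - log (cosh v))

/-- The logarithmic derivative in `r` of `letterG (1 / (1 + r)) v`. -/
noncomputable def letterJ (s v : ℝ) : ℝ :=
  log (cosh (s * v)) - s * v * (sinh (s * v) / cosh (s * v))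

/-- The slope of the curve `v ↦ (letterG s v, letterG s v * letterJ s v)`. -/
noncomputable def letterSlope (s v : ℝ) : ℝ :=
  log (cosh (s * v)) - (1 - s) * (s * v) * (sinh (s * v) / cosh (s * v))
    + s ^ 2 * v * (cosh ((1 - s) * v) / sinh ((1 - s) * v))

lemma hasDerivAt_log_cosh_mul (s v : ℝ) :
    HasDerivAt (fun v => log (cosh (s * v))) (sinh (s * v) * s / cosh (s * v)) v := by
  have h : HasDerivAt (fun v => s * v) s v := by simpa using (hasDerivAt_id v).const_mul s
  exact h.cosh.log (cosh_pos _).ne'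

lemma hasDerivAt_tanh_mul (s v : ℝ) :
    HasDerivAt (fun v => sinh (s * v) / cosh (s * v)) (s / cosh (s * v) ^ 2) v := by
  have h : HasDerivAt (fun v => s * v) s v := by simpa using (hasDerivAt_id v).const_mul s
  refine (h.sinh.div h.cosh (cosh_pos _).ne').congr_deriv ?_
  congr 1
  linear_combination s * cosh_sq (s * v)

lemma hasDerivAt_coth_mul {r v : ℝ} (hr : r * v ≠ 0) :
    HasDerivAt (fun v => cosh (r * v) / sinh (r * v)) (-r / sinh (r * v) ^ 2) v := by
  have h : HasDerivAt (fun v => r * v) r v := by simpa using (hasDerivAt_id v).const_mul r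
  refine (h.cosh.div h.sinh (by simpa using hr)).congr_deriv ?_
  congr 1
  linear_combination - r * cosh_sq (r * v)

lemma letterSlope_monotoneOn {s : ℝ} (hs : 1 / 4 < s) (hs1 : s < 1) :
    MonotoneOn (letterSlope s) (Set.Ioi 0) := by
  have hd : ∀ v : ℝ, 0 < v → HasDerivAt (letterSlope s)
      (sinh (s * v) * s / cosh (s * v)
        - ((1 - s) * s * (sinh (s * v) / cosh (s * v))
          + (1 - s) * (s * v) * (s / cosh (s * v) ^ 2))
        + (s ^ 2 * (cosh ((1 - s) * v) / sinh ((1 - s) * v))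
          + s ^ 2 * v * (-(1 - s) / sinh ((1 - s) * v) ^ 2))) v := by
    intro v hv
    have hr : (1 - s) * v ≠ 0 := (mul_pos (by linarith) hv).ne'
    have h1 : HasDerivAt (fun v => (1 - s) * (s * v)) ((1 - s) * s) v := by
      simpa [mul_assoc] using (hasDerivAt_id v).const_mul ((1 - s) * s)
    have h2 : HasDerivAt (fun v => s ^ 2 * v) (s ^ 2) v := by
      simpa using (hasDerivAt_id v).const_mul (s ^ 2)
    exact ((hasDerivAt_log_cosh_mul s v).sub (h1.mul (hasDerivAt_tanh_mul s v))).add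
      (h2.mul (hasDerivAt_coth_mul hr))
  refine monotoneOn_of_deriv_nonneg (convex_Ioi 0)
    (fun v hv => (hd v hv).continuousAt.continuousWithinAt)
    (fun v hv => (hd v (by simpa using hv)).differentiableAt.differentiableWithinAt)
    fun v hv => ?_
  have hv : 0 < v := by simpa using hv
  rw [(hd v hv).deriv]
  have hq : 0 < (1 - s) * v := mul_pos (by linarith) hv
  have key := mul_cosh_sub_le_cosh_mul_sinh (p := s * v) hq.le (by nlinarith)
  have hsq : 0 < sinh ((1 - s) * v) := sinh_pos_iff.2 hq
  have hcp := cosh_pos (s * v)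
  have hpq := cosh_pos ((1 - s) * v + s * v)
  have id1 : (sinh (s * v) * s / cosh (s * v)
        - ((1 - s) * s * (sinh (s * v) / cosh (s * v))
          + (1 - s) * (s * v) * (s / cosh (s * v) ^ 2))
        + (s ^ 2 * (cosh ((1 - s) * v) / sinh ((1 - s) * v))
          + s ^ 2 * v * (-(1 - s) / sinh ((1 - s) * v) ^ 2)))
      = s ^ 2 * cosh ((1 - s) * v + s * v) * (cosh (s * v) * sinh ((1 - s) * v)
          - (1 - s) * v * cosh ((1 - s) * v - s * v))
        / (cosh (s * v) ^ 2 * sinh ((1 - s) * v) ^ 2) := by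
    have c1 := cosh_sq (s * v)
    have c2 := cosh_sq ((1 - s) * v)
    rw [cosh_add, cosh_sub]
    generalize sinh (s * v) = a at *
    generalize cosh (s * v) = b at *
    generalize sinh ((1 - s) * v) = c at *
    generalize cosh ((1 - s) * v) = d at *
    field_simp
    have e : d ^ 2 * b ^ 2 - c ^ 2 * a ^ 2 = c ^ 2 + b ^ 2 := by rw [c1, c2]; ring
    linear_combination s * (1 - s) * v * e
  rw [id1]
  have : 0 ≤ cosh (s * v) * sinh ((1 - s) * v)
          - (1 - s) * v * cosh ((1 - s) * v - s * v) := by linarith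
  positivity

lemma hasDerivAt_letterG {s : ℝ} (hs : s ≠ 0) (v : ℝ) :
    HasDerivAt (letterG s)
      (letterG s v * (sinh (s * v) / cosh (s * v) - sinh v / cosh v)) v := by
  have h1 := hasDerivAt_log_cosh_mul 1 v
  simp only [one_mul, mul_one] at h1
  refine ((((hasDerivAt_log_cosh_mul s v).const_mul (1 / s)).sub h1).exp).congr_deriv ?_
  simp only [letterG]
  congr 1
  field_simp

lemma hasDerivAt_letterJ (s v : ℝ) :
    HasDerivAt (letterJ s) (- (s * v * (s / cosh (s * v) ^ 2))) v := by
  have h1 : HasDerivAt (fun v => s * v) s v := by simpa using (hasDerivAt_id v).const_mul s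
  refine ((hasDerivAt_log_cosh_mul s v).sub (h1.mul (hasDerivAt_tanh_mul s v))).congr_deriv ?_
  field_simp
  ring

lemma letterG_deriv_neg {s v : ℝ} (hs1 : s < 1) (hv : 0 < v) :
    letterG s v * (sinh (s * v) / cosh (s * v) - sinh v / cosh v) < 0 := by
  refine mul_neg_of_pos_of_neg (exp_pos _) ?_
  have h1 := cosh_pos (s * v)
  have h2 := cosh_pos v
  have h3 : 0 < sinh (v - s * v) := sinh_pos_iff.2 (by nlinarith)
  rw [sinh_sub] at h3
  rw [div_sub_div _ _ h1.ne' h2.ne']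
  exact div_neg_of_neg_of_pos (by linarith) (by positivity)

lemma hasDerivAt_letterG_mul_letterJ {s v : ℝ} (hs : 0 < s) (hs1 : s < 1) (hv : 0 < v) :
    HasDerivAt (fun v => letterG s v * letterJ s v)
      (letterSlope s v * (letterG s v * (sinh (s * v) / cosh (s * v) - sinh v / cosh v))) v := by
  refine ((hasDerivAt_letterG hs.ne' v).mul (hasDerivAt_letterJ s v)).congr_deriv ?_
  have hq : 0 < (1 - s) * v := mul_pos (by linarith) hv
  have hsq : 0 < sinh ((1 - s) * v) := sinh_pos_iff.2 hq
  have hcp := cosh_pos (s * v)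
  have hcv := cosh_pos v
  have c1 := cosh_sq (s * v)
  have ev : cosh v = cosh (s * v) * cosh ((1 - s) * v) + sinh (s * v) * sinh ((1 - s) * v) := by
    rw [← cosh_add]; ring_nf
  have ev' : sinh v = sinh (s * v) * cosh ((1 - s) * v) + cosh (s * v) * sinh ((1 - s) * v) := by
    rw [← sinh_add]; ring_nf
  rw [letterSlope, letterJ]
  rw [ev] at hcv
  rw [ev, ev']
  generalize sinh (s * v) = a at *
  generalize cosh (s * v) = b at *
  generalize sinh ((1 - s) * v) = c at *
  generalize cosh ((1 - s) * v) = d at *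
  have hcv := hcv.ne'
  have e : a / b - (a * d + b * c) / (b * d + a * c) = - c / (b * (b * d + a * c)) := by
    field_simp
    linear_combination (-c) * c1
  rw [e]
  generalize hD : b * d + a * c = D at *
  field_simp
  rw [← hD]
  ring

/-- A curve `(G, H)` with `G` increasing and slope `κ` antitone is the graph of a concave function. -/
lemma exists_concaveOn_of_slope_antitone {G G' H κ : ℝ → ℝ} {a b : ℝ}
    (hG : ContinuousOn G (Set.Icc a b)) (hH : ContinuousOn H (Set.Icc a b))
    (hG' : ∀ t ∈ Set.Ioo a b, HasDerivAt G (G' t) t)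
    (hH' : ∀ t ∈ Set.Ioo a b, HasDerivAt H (κ t * G' t) t)
    (hpos : ∀ t ∈ Set.Ioo a b, 0 < G' t) (hκ : AntitoneOn κ (Set.Ioo a b)) :
    StrictMonoOn G (Set.Icc a b) ∧
    ∃ φ : ℝ → ℝ, ConcaveOn ℝ (G '' Set.Icc a b) φ ∧ ∀ t ∈ Set.Icc a b, φ (G t) = H t := by
  have hmono : StrictMonoOn G (Set.Icc a b) := by
    refine strictMonoOn_of_deriv_pos (convex_Icc a b) hG fun t ht => ?_
    rw [interior_Icc] at ht
    rw [(hG' t ht).deriv]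
    exact hpos t ht
  have hφ : ∀ t ∈ Set.Icc a b, (H ∘ Function.invFunOn G (Set.Icc a b)) (G t) = H t :=
    fun t ht => congrArg H (hmono.injOn.leftInvOn_invFunOn ht)
  have slope : ∀ x ∈ Set.Icc a b, ∀ y ∈ Set.Icc a b, x < y →
      ∃ c ∈ Set.Ioo x y, (H y - H x) / (G y - G x) = κ c := by
    intro x hx y hy hxy
    have hsub : Set.Icc x y ⊆ Set.Icc a b := Set.Icc_subset_Icc hx.1 hy.2
    have hsub' : Set.Ioo x y ⊆ Set.Ioo a b := Set.Ioo_subset_Ioo hx.1 hy.2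
    obtain ⟨c, hc, h⟩ := exists_ratio_hasDerivAt_eq_ratio_slope H (fun t => κ t * G' t) hxy
      (hH.mono hsub) (fun t ht => hH' t (hsub' ht)) G G' (hG.mono hsub)
      (fun t ht => hG' t (hsub' ht))
    refine ⟨c, hc, ?_⟩
    have h1 := hpos c (hsub' hc)
    have h2 := hmono hx hy hxy
    rw [div_eq_iff (sub_pos.2 h2).ne']
    apply mul_right_cancel₀ h1.ne'
    linarith
  refine ⟨hmono, _, concaveOn_of_slope_anti_adjacent
    (isPreconnected_Icc.image _ hG).ordConnected.convex ?_, hφ⟩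
  intro p q r hp hr hpq hqr
  have hq : q ∈ G '' Set.Icc a b :=
    (isPreconnected_Icc.image _ hG).ordConnected.out hp hr ⟨hpq.le, hqr.le⟩
  obtain ⟨x, hx, rfl⟩ := hp
  obtain ⟨y, hy, rfl⟩ := hq
  obtain ⟨z, hz, rfl⟩ := hr
  rw [hφ x hx, hφ y hy, hφ z hz]
  have hxy := (hmono.lt_iff_lt hx hy).1 hpq
  have hyz := (hmono.lt_iff_lt hy hz).1 hqr
  obtain ⟨c, hc, h1⟩ := slope x hx y hy hxy
  obtain ⟨d, hd, h2⟩ := slope y hy z hz hyz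
  rw [h1, h2]
  exact hκ ⟨hx.1.trans_lt hc.1, hc.2.trans_le hy.2⟩ ⟨hy.1.trans_lt hd.1, hd.2.trans_le hz.2⟩
    (hc.2.trans hd.1).le

/-- Contribution to `∑_y (½ W(y|0)^{1/(1+r)} + ½ W(y|1)^{1/(1+r)})^{1+r}` of an output letter of
probability one whose likelihood ratio is `τ`. -/
noncomputable def ratioG (r τ : ℝ) : ℝ :=
  2 * ((1 + τ ^ (1 / (1 + r))) / 2) ^ (1 + r) / (1 + τ)

/-- The logarithmic derivative of `ratioG` in `r`, as a function of `u = τ ^ (1 / (1 + r))`. -/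
noncomputable def ratioJ (u : ℝ) : ℝ := log ((1 + u) / 2) - u * log u / (1 + u)

lemma ratioJ_nonpos {u : ℝ} (hu : 0 ≤ u) : ratioJ u ≤ 0 := by
  have h := convexOn_mul_log.2 (Set.mem_Ici.2 zero_le_one) (Set.mem_Ici.2 hu)
    (by norm_num : (0 : ℝ) ≤ 1 / 2) (by norm_num : (0 : ℝ) ≤ 1 / 2) (by norm_num)
  simp only [smul_eq_mul, log_one] at h
  have e : (1 / 2 * 1 + 1 / 2 * u) = (1 + u) / 2 := by ring
  rw [e] at h
  rw [ratioJ, sub_nonpos, le_div_iff₀ (by linarith)]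
  linarith

lemma ratioJ_neg {u : ℝ} (hu : 0 ≤ u) (hu1 : u < 1) : ratioJ u < 0 := by
  have h := strictConvexOn_mul_log.2 (Set.mem_Ici.2 zero_le_one) (Set.mem_Ici.2 hu) hu1.ne'
    (by norm_num : (0 : ℝ) < 1 / 2) (by norm_num : (0 : ℝ) < 1 / 2) (by norm_num)
  simp only [smul_eq_mul, log_one] at h
  have e : (1 / 2 * 1 + 1 / 2 * u) = (1 + u) / 2 := by ring
  rw [e] at h
  rw [ratioJ, sub_neg, lt_div_iff₀ (by linarith)]
  linarith

lemma continuousOn_ratioJ : ContinuousOn ratioJ (Set.Ici 0) := by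
  have h1 : ∀ u ∈ Set.Ici (0 : ℝ), (1 + u) / 2 ≠ 0 := fun u hu => by
    have : (0 : ℝ) ≤ u := hu
    positivity
  have h2 : ∀ u ∈ Set.Ici (0 : ℝ), (1 + u) ≠ 0 := fun u hu => by
    have : (0 : ℝ) ≤ u := hu
    positivity
  exact (ContinuousOn.log (by fun_prop) h1).sub
    ((continuous_mul_log.continuousOn).div (by fun_prop) h2)

lemma ratioG_pos {r τ : ℝ} (hτ : 0 ≤ τ) : 0 < ratioG r τ := by
  unfold ratioG; positivity

lemma ratioG_one {r : ℝ} : ratioG r 1 = 1 := by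
  norm_num [ratioG]

lemma ratioG_zero {r : ℝ} (hr : 0 < r) : ratioG r 0 = 2 ^ (-r) := by
  have h : (1 : ℝ) / (1 + r) ≠ 0 := by positivity
  rw [ratioG, zero_rpow h, add_zero, div_one, one_div, inv_rpow (by norm_num),
    ← rpow_neg (by norm_num)]
  nth_rewrite 1 [← rpow_one (2 : ℝ)]
  rw [← rpow_add (by norm_num)]
  congr 1; ring

lemma hasDerivAt_ratioG {r τ : ℝ} (hr : 0 < r) (hτ : 0 ≤ τ) :
    HasDerivAt (fun r => ratioG r τ) (ratioG r τ * ratioJ (τ ^ (1 / (1 + r)))) r := by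
  have hr1 : 1 + r ≠ 0 := by positivity
  have hadd : HasDerivAt (fun r : ℝ => 1 + r) 1 r := (hasDerivAt_id r).const_add 1
  have hinv : HasDerivAt (fun r : ℝ => 1 / (1 + r)) (-1 / (1 + r) ^ 2) r := by
    simpa using hadd.fun_inv hr1
  have hu : HasDerivAt (fun r => τ ^ (1 / (1 + r)))
      (-(τ ^ (1 / (1 + r)) * log (τ ^ (1 / (1 + r))) / (1 + r))) r := by
    rcases hτ.eq_or_lt with rfl | hτ
    · have h0 : (fun r : ℝ => (0 : ℝ) ^ (1 / (1 + r))) =ᶠ[nhds r] fun _ => 0 := by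
        filter_upwards [lt_mem_nhds hr] with x hx
        exact zero_rpow (by positivity)
      rw [h0.eq_of_nhds]
      simpa using (hasDerivAt_const r (0 : ℝ)).congr_of_eventuallyEq h0
    · refine (hinv.const_rpow hτ).congr_deriv ?_
      rw [log_rpow hτ]
      field_simp
  have hu0 : 0 ≤ τ ^ (1 / (1 + r)) := rpow_nonneg hτ _
  have h := ((((hu.const_add 1).div_const 2).rpow hadd (by positivity)).const_mul 2).div_const
    (1 + τ)
  refine h.congr_deriv ?_
  have hX : 0 < (1 + τ ^ (1 / (1 + r))) / 2 := by positivity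
  rw [ratioG, ratioJ, rpow_sub_one hX.ne']
  field_simp
  ring

lemma continuousOn_ratioG {r : ℝ} (hr : 0 < r) : ContinuousOn (ratioG r) (Set.Icc 0 1) := by
  have hs : 0 ≤ 1 / (1 + r) := by positivity
  refine ContinuousOn.div ?_ (by fun_prop) fun t ht => ?_
  · exact (((continuous_rpow_const hs).const_add 1).div_const 2 |>.rpow_const
      (fun _ => Or.inr (by positivity))).const_mul 2 |>.continuousOn
  · have := ht.1
    positivity

lemma rpow_half_sum_eq {r a b : ℝ} (hr : 0 < r) (ha : 0 ≤ a) (hb : 0 ≤ b) :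
    ((1 / 2) * a ^ (1 / (1 + r)) + (1 / 2) * b ^ (1 / (1 + r))) ^ (1 + r)
      = (a + b) / 2 * ratioG r (min a b / max a b) := by
  wlog hab : b ≤ a generalizing a b
  · rw [min_comm, max_comm, add_comm a, ← this hb ha (le_of_not_ge hab), add_comm (_ * b ^ _)]
  rw [min_eq_right hab, max_eq_left hab]
  rcases ha.eq_or_lt with rfl | ha
  · obtain rfl : b = 0 := le_antisymm hab hb
    have h : (1 : ℝ) / (1 + r) ≠ 0 := by positivity
    have h' : 1 + r ≠ 0 := by positivity
    rw [zero_rpow h]; simp [zero_rpow h']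
  · rw [ratioG, div_rpow hb ha.le]
    have hs : 0 < a ^ (1 / (1 + r)) := rpow_pos_of_pos ha _
    have hs' : 0 ≤ b ^ (1 / (1 + r)) := rpow_nonneg hb _
    have e : (1 / 2) * a ^ (1 / (1 + r)) + (1 / 2) * b ^ (1 / (1 + r))
        = a ^ (1 / (1 + r)) * ((1 + b ^ (1 / (1 + r)) / a ^ (1 / (1 + r))) / 2) := by
      field_simp
    rw [e, mul_rpow hs.le (by positivity), ← rpow_mul ha.le,
      one_div_mul_cancel (by positivity), rpow_one]
    field_simp

lemma ratioG_exp {r : ℝ} (hr : 0 < r) (v : ℝ) :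
    ratioG r (exp (-2 * v)) = letterG (1 / (1 + r)) v := by
  have h1 : ∀ x : ℝ, 1 + exp (-2 * x) = 2 * exp (-x) * cosh x := fun x => by
    rw [cosh_eq, mul_div_assoc', mul_add, mul_assoc, mul_assoc, ← exp_add, ← exp_add]
    ring_nf; simp; ring
  have h2 : exp (-2 * v) ^ (1 / (1 + r)) = exp (-2 * (1 / (1 + r) * v)) := by
    rw [← exp_mul]; ring_nf
  have hc := cosh_pos (1 / (1 + r) * v)
  rw [ratioG, h2, h1, h1, letterG, mul_assoc, mul_div_cancel_left₀ _ two_ne_zero,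
    rpow_def_of_pos (by positivity), log_mul (exp_pos _).ne' hc.ne', log_exp, exp_sub,
    exp_log (cosh_pos v)]
  have h3 : (-(1 / (1 + r) * v) + log (cosh (1 / (1 + r) * v))) * (1 + r)
      = -v + 1 / (1 / (1 + r)) * log (cosh (1 / (1 + r) * v)) := by
    field_simp
  rw [h3, exp_add]
  have := cosh_pos v
  field_simp

lemma ratioJ_exp (p : ℝ) :
    ratioJ (exp (-2 * p)) = log (cosh p) - p * (sinh p / cosh p) := by
  have h1 : 1 + exp (-2 * p) = 2 * exp (-p) * cosh p := by
    rw [cosh_eq, mul_div_assoc', mul_add, mul_assoc, mul_assoc, ← exp_add, ← exp_add]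
    ring_nf; simp; ring
  have hc := cosh_pos p
  have h2 : exp (-2 * p) = exp (-p) * (cosh p - sinh p) := by
    rw [cosh_sub_sinh, ← exp_add]; ring_nf
  rw [ratioJ, h1, log_exp, mul_assoc, mul_div_cancel_left₀ _ two_ne_zero,
    log_mul (exp_pos _).ne' hc.ne', log_exp, h2]
  field_simp
  ring

lemma exists_concaveOn_ratioG {r : ℝ} (hr : r ∈ Set.Ioo (0 : ℝ) 3) :
    StrictMonoOn (ratioG r) (Set.Icc 0 1) ∧
    ∃ φ : ℝ → ℝ, ConcaveOn ℝ (ratioG r '' Set.Icc 0 1) φ ∧ ∀ t ∈ Set.Icc (0 : ℝ) 1,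
      φ (ratioG r t) = ratioG r t * ratioJ (t ^ (1 / (1 + r))) := by
  obtain ⟨hr, hr3⟩ := hr
  have hs : 0 < 1 / (1 + r) := by positivity
  have hs1 : 1 / (1 + r) < 1 := by rw [div_lt_one (by positivity)]; linarith
  have hs4 : 1 / 4 < 1 / (1 + r) := one_div_lt_one_div_of_lt (by positivity) (by linarith)
  have hexp : ∀ t : ℝ, 0 < t → exp (-2 * (-(1 / 2) * log t)) = t := fun t ht => by
    rw [← mul_assoc]; norm_num [exp_log ht]
  have hvd : ∀ t : ℝ, 0 < t → HasDerivAt (fun t => -(1 / 2) * log t) (-(1 / 2) * t⁻¹) t :=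
    fun t ht => (hasDerivAt_log ht.ne').const_mul _
  have hv : ∀ t ∈ Set.Ioo (0 : ℝ) 1, 0 < -(1 / 2) * log t := fun t ht => by
    linarith [log_neg ht.1 ht.2]
  have hGe : ∀ t : ℝ, 0 < t → ratioG r t = letterG (1 / (1 + r)) (-(1 / 2) * log t) :=
    fun t ht => by rw [← ratioG_exp hr, hexp t ht]
  have hJe : ∀ t : ℝ, 0 < t →
      ratioJ (t ^ (1 / (1 + r))) = letterJ (1 / (1 + r)) (-(1 / 2) * log t) := fun t ht => by
    rw [letterJ, ← ratioJ_exp, rpow_def_of_pos ht]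
    ring_nf
  refine exists_concaveOn_of_slope_antitone
    (G' := fun t => (letterG (1 / (1 + r)) (-(1 / 2) * log t) *
      (sinh (1 / (1 + r) * (-(1 / 2) * log t)) / cosh (1 / (1 + r) * (-(1 / 2) * log t))
        - sinh (-(1 / 2) * log t) / cosh (-(1 / 2) * log t))) * (-(1 / 2) * t⁻¹))
    (κ := fun t => letterSlope (1 / (1 + r)) (-(1 / 2) * log t))
    (continuousOn_ratioG hr) ?_ ?_ ?_ ?_ ?_
  · refine (continuousOn_ratioG hr).mul (continuousOn_ratioJ.comp
      (continuous_rpow_const hs.le).continuousOn fun t ht => rpow_nonneg ht.1 _)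
  · intro t ht
    refine ((hasDerivAt_letterG hs.ne' _).comp t (hvd t ht.1)).congr_of_eventuallyEq ?_
    filter_upwards [lt_mem_nhds ht.1] with x hx using hGe x hx
  · intro t ht
    refine (((hasDerivAt_letterG_mul_letterJ hs hs1 (hv t ht)).comp t
      (hvd t ht.1)).congr_of_eventuallyEq ?_).congr_deriv (mul_assoc _ _ _)
    filter_upwards [lt_mem_nhds ht.1] with x hx
    simp only [Function.comp]
    rw [hGe x hx, hJe x hx]
  · intro t ht
    have := letterG_deriv_neg hs1 (hv t ht)
    exact mul_pos_of_neg_of_neg this (by simpa using ht.1)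
  · intro x hx y hy hxy
    exact letterSlope_monotoneOn hs4 hs1 (hv y hy) (hv x hx)
      (by linarith [log_le_log hx.1 hxy])

lemma ConcaveOn.le_of_nonpos_right {S : Set ℝ} {φ : ℝ → ℝ} (hφ : ConcaveOn ℝ S φ) {b m t : ℝ}
    (hm : m ∈ S) (hb : b ∈ S) (hφb : φ b = 0) (hφm : φ m ≤ 0) (hmt : m ≤ t) (htb : t ≤ b) :
    φ m ≤ φ t := by
  rcases hmt.eq_or_lt with rfl | hmt
  · exact le_rfl
  have hmb : 0 < b - m := by linarith
  have h := hφ.2 hm hb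
    (show 0 ≤ (b - t) / (b - m) from div_nonneg (by linarith) hmb.le)
    (show 0 ≤ (t - m) / (b - m) from div_nonneg (by linarith) hmb.le) (by field_simp; ring)
  have e : (b - t) / (b - m) * m + (t - m) / (b - m) * b = t := by field_simp; ring
  simp only [smul_eq_mul, e, hφb, mul_zero, add_zero] at h
  have h1 : (b - t) / (b - m) ≤ 1 := (div_le_one hmb).2 (by linarith)
  nlinarith

lemma ConcaveOn.chord_le {S : Set ℝ} {φ : ℝ → ℝ} (hφ : ConcaveOn ℝ S φ) {a b t : ℝ}
    (ha : a ∈ S) (hb : b ∈ S) (hφb : φ b = 0) (hab : a < b) (hat : a ≤ t) (htb : t ≤ b) :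
    (b - t) / (b - a) * φ a ≤ φ t := by
  have hab' : 0 < b - a := by linarith
  have h := hφ.2 ha hb
    (show 0 ≤ (b - t) / (b - a) from div_nonneg (by linarith) hab'.le)
    (show 0 ≤ (t - a) / (b - a) from div_nonneg (by linarith) hab'.le) (by field_simp; ring)
  have e : (b - t) / (b - a) * a + (t - a) / (b - a) * b = t := by field_simp; ring
  simpa only [smul_eq_mul, e, hφb, mul_zero, add_zero] using h

/-- The output distribution of a channel under the uniform input distribution. -/
noncomputable def outProb (W : BDMC) (y : W.Y) : ℝ := (W.W0 y + W.W1 y) / 2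

/-- The likelihood ratio of an output letter, normalised to be at most one. -/
noncomputable def likRatio (W : BDMC) (y : W.Y) : ℝ := min (W.W0 y) (W.W1 y) / max (W.W0 y) (W.W1 y)

lemma outProb_nonneg (W : BDMC) (y : W.Y) : 0 ≤ outProb W y := by
  have := W.W0_nonneg y
  have := W.W1_nonneg y
  unfold outProb; positivity

lemma sum_outProb (W : BDMC) : ∑ y, outProb W y = 1 := by
  simp only [outProb, ← Finset.sum_div, Finset.sum_add_distrib, W.sum_W0, W.sum_W1]
  norm_num

lemma likRatio_mem (W : BDMC) (y : W.Y) : likRatio W y ∈ Set.Icc (0 : ℝ) 1 := by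
  have h0 := W.W0_nonneg y
  have h1 := W.W1_nonneg y
  have hm : 0 ≤ max (W.W0 y) (W.W1 y) := h0.trans (le_max_left _ _)
  exact ⟨div_nonneg (le_min h0 h1) hm, div_le_one_of_le₀ min_le_max hm⟩

lemma E0_eq {r : ℝ} (hr : 0 < r) (W : BDMC) :
    E0 r W = -log (∑ y, outProb W y * ratioG r (likRatio W y)) := by
  simp only [E0, outProb, likRatio, rpow_half_sum_eq hr (W.W0_nonneg _) (W.W1_nonneg _)]

lemma sum_outProb_mul_ratioG_pos {r : ℝ} (W : BDMC) :
    0 < ∑ y, outProb W y * ratioG r (likRatio W y) := by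
  have hnn : ∀ y ∈ Finset.univ, 0 ≤ outProb W y * ratioG r (likRatio W y) := fun y _ =>
    mul_nonneg (outProb_nonneg W y) (ratioG_pos (likRatio_mem W y).1).le
  refine (Finset.sum_nonneg hnn).lt_of_ne' fun h => ?_
  rw [Finset.sum_eq_zero_iff_of_nonneg hnn] at h
  have h0 : ∑ y, outProb W y = 0 := Finset.sum_eq_zero fun y hy =>
    (mul_eq_zero.1 (h y hy)).resolve_right (ratioG_pos (likRatio_mem W y).1).ne'
  rw [sum_outProb] at h0
  exact one_ne_zero h0

lemma RW_eq {r : ℝ} (hr : 0 < r) (W : BDMC) :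
    RW r W = -((∑ y, outProb W y * (ratioG r (likRatio W y)
        * ratioJ (likRatio W y ^ (1 / (1 + r)))))
      / ∑ y, outProb W y * ratioG r (likRatio W y)) := by
  have h : HasDerivAt (fun r => ∑ y, outProb W y * ratioG r (likRatio W y))
      (∑ y, outProb W y * (ratioG r (likRatio W y) * ratioJ (likRatio W y ^ (1 / (1 + r))))) r :=
    HasDerivAt.fun_sum fun y _ => (hasDerivAt_ratioG hr (likRatio_mem W y).1).const_mul _
  refine HasDerivAt.deriv ?_
  refine (h.log (sum_outProb_mul_ratioG_pos W).ne').fun_neg.congr_of_eventuallyEq ?_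
  filter_upwards [lt_mem_nhds hr] with x hx using E0_eq hx W

lemma E0bsc_eq {r x : ℝ} (hr : 0 < r) (hx : x ∈ Set.Icc (0 : ℝ) (1 / 2)) :
    E0bsc r x = -log (ratioG r (x / (1 - x))) := by
  obtain ⟨h0, h1⟩ := hx
  have hx1 : 0 < 1 - x := by linarith
  have h := rpow_half_sum_eq hr h0 hx1.le
  have hp : 0 ≤ x ^ (1 / (1 + r)) + (1 - x) ^ (1 / (1 + r)) :=
    add_nonneg (rpow_nonneg h0 _) (rpow_nonneg hx1.le _)
  rw [min_eq_left (by linarith), max_eq_right (by linarith), ← mul_add,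
    mul_rpow (by norm_num) hp] at h
  have e : (2 : ℝ) ^ (-r) = 2 * (1 / 2) ^ (1 + r) := by
    rw [one_div, inv_rpow (by norm_num), ← rpow_neg (by norm_num)]
    nth_rewrite 2 [← rpow_one (2 : ℝ)]
    rw [← rpow_add (by norm_num)]
    congr 1; ring
  rw [E0bsc, e, mul_assoc, h]
  congr 2; ring

lemma Rbsc_eq {r x : ℝ} (hr : 0 < r) (hx : x ∈ Set.Icc (0 : ℝ) (1 / 2)) :
    Rbsc r x = -(ratioG r (x / (1 - x)) * ratioJ ((x / (1 - x)) ^ (1 / (1 + r)))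
      / ratioG r (x / (1 - x))) := by
  have h0 : 0 ≤ x / (1 - x) := div_nonneg hx.1 (by linarith [hx.2])
  refine HasDerivAt.deriv ?_
  refine ((hasDerivAt_ratioG hr h0).log (ratioG_pos h0).ne').fun_neg.congr_of_eventuallyEq ?_
  filter_upwards [lt_mem_nhds hr] with s hs using E0bsc_eq hs hx

lemma Rbec_eq {r ε : ℝ} (hε : ε ∈ Set.Icc (0 : ℝ) 1) :
    Rbec r ε = log 2 * 2 ^ (-r) * (1 - ε) / (2 ^ (-r) * (1 - ε) + ε) := by
  have hpos : 0 < (2 : ℝ) ^ (-r) * (1 - ε) + ε := by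
    have h2 : (0 : ℝ) < 2 ^ (-r) := by positivity
    rcases hε.1.eq_or_lt with rfl | h
    · simpa using h2
    · have := mul_nonneg h2.le (sub_nonneg.2 hε.2)
      linarith
  have h : HasDerivAt (fun r : ℝ => (2 : ℝ) ^ (-r) * (1 - ε) + ε)
      (log 2 * -1 * 2 ^ (-r) * (1 - ε)) r :=
    (((hasDerivAt_neg r).const_rpow (by norm_num)).mul_const _).add_const _
  refine HasDerivAt.deriv ((h.log hpos.ne').fun_neg.congr_deriv ?_)
  ring

/-- Lemma 7: for `ρ ∈ (0,3)`, if `E₀(ρ, BSC_x) ≤ E₀(ρ, W) ≤ E₀(ρ, BEC_ε)` then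
`R(ρ, BSC_x) ≤ R(ρ, W) ≤ R(ρ, BEC_ε)`, strictly whenever both hypotheses are strict. -/
theorem rate_extremality_pos (W : BDMC) (ε x ρ : ℝ)
    (hε : ε ∈ Set.Icc (0:ℝ) 1) (hx : x ∈ Set.Icc (0:ℝ) (1/2))
    (hρ : ρ ∈ Set.Ioo (0:ℝ) 3)
    (hBSC : E0bsc ρ x ≤ E0 ρ W) (hBEC : E0 ρ W ≤ E0bec ρ ε) :
    (Rbsc ρ x ≤ RW ρ W ∧ RW ρ W ≤ Rbec ρ ε) ∧
    (E0bsc ρ x < E0 ρ W → E0 ρ W < E0bec ρ ε →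
      Rbsc ρ x < RW ρ W ∧ RW ρ W < Rbec ρ ε) := by
  have hr := hρ.1
  obtain ⟨hmono, φ, hφ, hφG⟩ := exists_concaveOn_ratioG hρ
  have hxt : x / (1 - x) ∈ Set.Icc (0 : ℝ) 1 :=
    ⟨div_nonneg hx.1 (by linarith [hx.2]),
      div_le_one_of_le₀ (by linarith [hx.2]) (by linarith [hx.2])⟩
  have h0 : (0 : ℝ) ∈ Set.Icc (0 : ℝ) 1 := ⟨le_rfl, zero_le_one⟩
  have h1 : (1 : ℝ) ∈ Set.Icc (0 : ℝ) 1 := ⟨zero_le_one, le_rfl⟩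
  have hS : ∀ t ∈ Set.Icc (0 : ℝ) 1, ratioG ρ t ∈ ratioG ρ '' Set.Icc 0 1 :=
    fun t ht => Set.mem_image_of_mem _ ht
  have hS0 := hS 0 h0
  have hS1 := hS 1 h1
  have hle1 : ∀ t ∈ Set.Icc (0 : ℝ) 1, ratioG ρ t ≤ 1 := fun t ht => by
    simpa [ratioG_one] using hmono.monotoneOn ht h1 ht.2
  have hge0 : ∀ t ∈ Set.Icc (0 : ℝ) 1, 2 ^ (-ρ) ≤ ratioG ρ t := fun t ht => by
    simpa [ratioG_zero hr] using hmono.monotoneOn h0 ht ht.1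
  have hlt : (2 : ℝ) ^ (-ρ) < 1 := by
    simpa [ratioG_zero hr, ratioG_one] using hmono h0 h1 zero_lt_one
  have hφ1 : φ 1 = 0 := by
    have := hφG 1 h1
    simpa [ratioG_one, ratioJ] using this
  have hφ0 : φ (2 ^ (-ρ)) = -(log 2 * 2 ^ (-ρ)) := by
    have h := hφG 0 h0
    have hs : (1 : ℝ) / (1 + ρ) ≠ 0 := by positivity
    rw [ratioG_zero hr, zero_rpow hs] at h
    rw [h]
    simp [ratioJ]
    ring
  rw [ratioG_zero hr] at hS0
  rw [ratioG_one] at hS1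
  have hφneg : ∀ p ∈ ratioG ρ '' Set.Icc 0 1, p < 1 → φ p < 0 := by
    rintro _ ⟨t, ht, rfl⟩ h
    rw [hφG t ht]
    refine mul_neg_of_pos_of_neg (ratioG_pos ht.1) (ratioJ_neg (rpow_nonneg ht.1 _) ?_)
    have ht1 : t < 1 := ht.2.lt_of_ne fun e => by simp [e, ratioG_one] at h
    exact rpow_lt_one ht.1 ht1 (by positivity)
  have hφnonpos : ∀ p ∈ ratioG ρ '' Set.Icc 0 1, φ p ≤ 0 := by
    rintro _ ⟨t, ht, rfl⟩
    rw [hφG t ht]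
    exact mul_nonpos_of_nonneg_of_nonpos (ratioG_pos ht.1).le (ratioJ_nonpos (rpow_nonneg ht.1 _))
  have hmpos := sum_outProb_mul_ratioG_pos (r := ρ) W
  rw [E0bsc_eq hr hx, E0_eq hr W] at *
  rw [Rbsc_eq hr hx, RW_eq hr W, Rbec_eq hε, ← hφG _ hxt]
  simp only [← hφG _ (likRatio_mem W _)]
  have hJensen : ∑ y, outProb W y * φ (ratioG ρ (likRatio W y))
      ≤ φ (∑ y, outProb W y * ratioG ρ (likRatio W y)) :=
    hφ.le_map_sum (fun y _ => outProb_nonneg W y) (sum_outProb W)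
      fun y _ => hS _ (likRatio_mem W y)
  have hmS : ∑ y, outProb W y * ratioG ρ (likRatio W y) ∈ ratioG ρ '' Set.Icc 0 1 :=
    hφ.1.sum_mem (fun y _ => outProb_nonneg W y) (sum_outProb W)
      fun y _ => hS _ (likRatio_mem W y)
  have hd : 0 < 1 - (2 : ℝ) ^ (-ρ) := by linarith
  have hchord : -((1 - ∑ y, outProb W y * ratioG ρ (likRatio W y)) / (1 - 2 ^ (-ρ))
        * (log 2 * 2 ^ (-ρ)))
      ≤ ∑ y, outProb W y * φ (ratioG ρ (likRatio W y)) := by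
    have h : ∑ y, outProb W y * ((1 - ratioG ρ (likRatio W y)) / (1 - 2 ^ (-ρ)) * φ (2 ^ (-ρ)))
        ≤ ∑ y, outProb W y * φ (ratioG ρ (likRatio W y)) :=
      Finset.sum_le_sum fun y _ => mul_le_mul_of_nonneg_left
        (hφ.chord_le hS0 hS1 hφ1 hlt (hge0 _ (likRatio_mem W y)) (hle1 _ (likRatio_mem W y)))
        (outProb_nonneg W y)
    refine le_trans (le_of_eq ?_) h
    rw [hφ0, ← sum_outProb W, ← Finset.sum_sub_distrib, sum_outProb W, Finset.sum_div,
      Finset.sum_mul, ← Finset.sum_neg_distrib]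
    exact Finset.sum_congr rfl fun y _ => by ring
  have htS := hS _ hxt
  have htpos := ratioG_pos (r := ρ) hxt.1
  have ht1 := hle1 _ hxt
  generalize ratioG ρ (x / (1 - x)) = t at *
  generalize ∑ y, outProb W y * φ (ratioG ρ (likRatio W y)) = n at *
  generalize ∑ y, outProb W y * ratioG ρ (likRatio W y) = m at *
  have hg : 0 < (2 : ℝ) ^ (-ρ) := by positivity
  have hl2 : 0 < log 2 := log_pos (by norm_num)
  have hepos : 0 < (2 : ℝ) ^ (-ρ) * (1 - ε) + ε := by
    have := hε.1
    nlinarith [hε.2]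
  unfold E0bec at *
  generalize (2 : ℝ) ^ (-ρ) = g at *
  obtain ⟨e, he⟩ : ∃ e, e = g * (1 - ε) + ε := ⟨_, rfl⟩
  have he' : log 2 * g * (1 - ε) = (1 - e) / (1 - g) * (log 2 * g) := by
    rw [he]; field_simp; ring
  rw [he', ← he]
  rw [← he] at hepos hBEC
  have hLg : 0 < log 2 * g / (1 - g) := by positivity
  simp only [neg_le_neg_iff, neg_lt_neg_iff, log_le_log_iff, log_lt_log_iff, hmpos, htpos,
    hepos] at hBSC hBEC ⊢
  have hmt := hφ.le_of_nonpos_right hmS hS1 hφ1 (hφnonpos _ hmS) hBSC ht1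
  have hn : n ≤ 0 := hJensen.trans (hφnonpos _ hmS)
  have ht0 := hφnonpos _ htS
  have hchord' : -n ≤ (1 - m) * (log 2 * g / (1 - g)) := by
    have e1 : (1 - m) / (1 - g) * (log 2 * g) = (1 - m) * (log 2 * g / (1 - g)) := by ring
    linarith
  have e2 : (1 - e) / (1 - g) * (log 2 * g) = (1 - e) * (log 2 * g / (1 - g)) := by ring
  rw [e2, ← neg_div]
  generalize log 2 * g / (1 - g) = L at *
  refine ⟨⟨?_, ?_⟩, fun h3 h4 => ⟨?_, ?_⟩⟩
  · rw [div_le_div_iff₀ hmpos htpos]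
    calc n * t ≤ n * m := mul_le_mul_of_nonpos_left hBSC hn
      _ ≤ φ t * m := mul_le_mul_of_nonneg_right (hJensen.trans hmt) hmpos.le
  · rw [div_le_div_iff₀ hmpos hepos]
    linarith [mul_le_mul_of_nonneg_right hchord' hepos.le, mul_le_mul_of_nonneg_left hBEC hLg.le]
  · have := hφneg m hmS (h3.trans_le ht1)
    rw [div_lt_div_iff₀ hmpos htpos]
    calc n * t < n * m := mul_lt_mul_of_neg_left h3 (hJensen.trans_lt this)
      _ ≤ φ t * m := mul_le_mul_of_nonneg_right (hJensen.trans hmt) hmpos.le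
  · rw [div_lt_div_iff₀ hmpos hepos]
    linarith [mul_le_mul_of_nonneg_right hchord' hepos.le, mul_lt_mul_of_pos_left h4 hLg]
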